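/- Define G : ℝ³ → ℝ³ by G(a,b,c) = (½(b + √(4a+b²+c²)), ½(−b + √(4a+b²+c²)), c/2). Then G is infinitely differentiable (C^∞) on the open set {(a,b,c) ∈ ℝ³ : 4a + b² + c² > 0}, and for every (a,b,c) with a ≥ 0 one has F₂(G(a,b,c)) = (a,b,c), where F₂(α,β,γ) = (αβ − γ², α − β, 2γ). -/

import Mathlib

/-- The map `F₂(α,β,γ) = (αβ − γ², α − β, 2γ)`. -/
def F2 (x : ℝ × ℝ × ℝ) : ℝ × ℝ × ℝ :=
  (x.1 * x.2.1 - x.2.2 ^ 2, x.1 - x.2.1, 2 * x.2.2)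

/-- The map `G(a,b,c) = (½(b + √(4a+b²+c²)), ½(−b + √(4a+b²+c²)), c/2)`. -/
noncomputable def Ginv (x : ℝ × ℝ × ℝ) : ℝ × ℝ × ℝ :=
  ((x.2.1 + Real.sqrt (4 * x.1 + x.2.1 ^ 2 + x.2.2 ^ 2)) / 2,
   (-x.2.1 + Real.sqrt (4 * x.1 + x.2.1 ^ 2 + x.2.2 ^ 2)) / 2,
   x.2.2 / 2)

/-- `G` is `C^∞` on the open set `{(a,b,c) : 4a + b² + c² > 0}`, and
`F₂(G(a,b,c)) = (a,b,c)` whenever `a ≥ 0`. -/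
theorem Ginv_smooth_and_rightInverse :
    ContDiffOn ℝ (⊤ : ℕ∞) Ginv {x : ℝ × ℝ × ℝ | 0 < 4 * x.1 + x.2.1 ^ 2 + x.2.2 ^ 2} ∧
    ∀ x : ℝ × ℝ × ℝ, 0 ≤ x.1 → F2 (Ginv x) = x := by
  constructor
  · have hs : ContDiffOn ℝ (⊤ : ℕ∞)
        (fun x : ℝ × ℝ × ℝ => Real.sqrt (4 * x.1 + x.2.1 ^ 2 + x.2.2 ^ 2))
        {x : ℝ × ℝ × ℝ | 0 < 4 * x.1 + x.2.1 ^ 2 + x.2.2 ^ 2} :=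
      ContDiffOn.sqrt (by fun_prop) fun x hx => ne_of_gt hx
    have hb : ContDiffOn ℝ (⊤ : ℕ∞) (fun x : ℝ × ℝ × ℝ => x.2.1)
        {x : ℝ × ℝ × ℝ | 0 < 4 * x.1 + x.2.1 ^ 2 + x.2.2 ^ 2} := by fun_prop
    have hc : ContDiffOn ℝ (⊤ : ℕ∞) (fun x : ℝ × ℝ × ℝ => x.2.2)
        {x : ℝ × ℝ × ℝ | 0 < 4 * x.1 + x.2.1 ^ 2 + x.2.2 ^ 2} := by fun_prop
    exact ((hb.add hs).div_const 2).prodMk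
      (((hb.neg.add hs).div_const 2).prodMk (hc.div_const 2))
  · rintro ⟨a, b, c⟩ ha
    have ha' : 0 ≤ a := ha
    have hsq := Real.sq_sqrt (show 0 ≤ 4 * a + b ^ 2 + c ^ 2 by positivity)
    simp only [F2, Ginv, Prod.mk.injEq]
    refine ⟨?_, ?_, ?_⟩
    · linear_combination hsq / 4
    · ring
    · ring
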